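/- arXiv:2409.04451 — 5 statements merged into one kernel-verified Lean document; each statement's English description precedes it below -/
import Mathlib

section
/- Let p be a prime with p ≡ 1 (mod 6), and let f be the multiplicative order of 5 modulo p; assume 3 divides f. If N is a friend of 20 and v₅(N) ≡ −1 (mod f), then there exists an odd prime q dividing N such that v_q(N) is not congruent to −1 modulo f. -/
/-- `N` is a friend of `20`: `N > 20` and `σ(N)/N = 21/10`, i.e. `10·σ(N) = 21·N`. -/
def IsFriendOf20 (N : ℕ) : Prop :=
  20 < N ∧ 10 * ArithmeticFunction.sigma 1 N = 21 * N

open ArithmeticFunction in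
/-- The divisors `d * k` with `d ∣ a`, together with `1`, bound `σ (a * k)` from below. -/
theorem sigma_one_mul_lt_sigma_one_mul {a k : ℕ} (ha : a ≠ 0) (hk : 1 < k) :
    sigma 1 a * k < sigma 1 (a * k) := by
  have hinj : Set.InjOn (fun d : ℕ => d * k) a.divisors := fun x _ y _ h =>
    Nat.eq_of_mul_eq_mul_right (by omega) h
  rw [sigma_one_apply, sigma_one_apply, Finset.sum_mul,
    ← Finset.sum_image (f := fun d : ℕ => d) hinj]
  refine Finset.sum_lt_sum_of_subset (i := 1) ?_ ?_ ?_ one_pos (by simp)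
  · intro x hx
    obtain ⟨d, hd, rfl⟩ := Finset.mem_image.1 hx
    exact Nat.mem_divisors.2
      ⟨mul_dvd_mul_right (Nat.dvd_of_mem_divisors hd) k, mul_ne_zero ha (by omega)⟩
  · exact Nat.one_mem_divisors.2 (mul_ne_zero ha (by omega))
  · intro h
    obtain ⟨d, -, hd⟩ := Finset.mem_image.1 h
    have := (mul_eq_one.1 hd).2
    omega

open ArithmeticFunction in
theorem sq_add_self_add_one_dvd_sigma_one {q n : ℕ} (hq : q.Prime) (hn : n ≠ 0)
    (h : 3 ∣ n.factorization q + 1) : q ^ 2 + q + 1 ∣ sigma 1 n := by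
  have hmul : sigma 1 n =
      sigma 1 (q ^ n.factorization q) * sigma 1 (n / q ^ n.factorization q) := by
    rw [← isMultiplicative_sigma.map_mul_of_coprime
      ((Nat.coprime_ordCompl hq hn).pow_left _), Nat.ordProj_mul_ordCompl_eq_self]
  rw [hmul]
  refine Dvd.dvd.mul_right ?_ _
  obtain ⟨j, hj⟩ := h
  rw [sigma_one_apply_prime_pow hq, hj]
  clear hj
  induction j with
  | zero => simp
  | succ j ih =>
    rw [mul_add, mul_one, Finset.sum_range_succ, Finset.sum_range_succ, Finset.sum_range_succ]
    have hsum := dvd_add ih (Dvd.intro (q ^ (3 * j)) rfl)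
    convert hsum using 1
    ring

theorem IsFriendOf20.not_twenty_dvd {N : ℕ} (hN : IsFriendOf20 N) : ¬ 20 ∣ N := by
  rintro ⟨k, rfl⟩
  obtain ⟨hlt, hσ⟩ := hN
  have h := sigma_one_mul_lt_sigma_one_mul (a := 20) (k := k) (by norm_num) (by omega)
  have h20 : ArithmeticFunction.sigma 1 20 = 42 := by decide
  rw [h20] at h
  omega

theorem IsFriendOf20.not_thirty_dvd {N : ℕ} (hN : IsFriendOf20 N) : ¬ 30 ∣ N := by
  rintro ⟨k, rfl⟩
  obtain ⟨hlt, hσ⟩ := hN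
  have h30 : ArithmeticFunction.sigma 1 30 = 72 := by decide
  obtain rfl | hk : k = 1 ∨ 1 < k := by omega
  · rw [mul_one, h30] at hσ
    omega
  · have h := sigma_one_mul_lt_sigma_one_mul (a := 30) (by norm_num) hk
    rw [h30] at h
    omega

/-- A friend of `20` is twice an odd number `m` with `σ(m)/m = 7/5`. -/
theorem IsFriendOf20.exists_eq_two_mul {N : ℕ} (hN : IsFriendOf20 N) :
    ∃ m, N = 2 * m ∧ Odd m ∧ 5 ∣ m ∧ 5 * ArithmeticFunction.sigma 1 m = 7 * m := by
  have h20 := hN.not_twenty_dvd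
  obtain ⟨-, hσ⟩ := hN
  obtain ⟨m, rfl⟩ : 2 ∣ N := by omega
  have hm : Odd m := by
    rw [Nat.odd_iff]
    omega
  have hmul : ArithmeticFunction.sigma 1 (2 * m) = 3 * ArithmeticFunction.sigma 1 m := by
    rw [ArithmeticFunction.isMultiplicative_sigma.map_mul_of_coprime
      (Nat.coprime_two_left.2 hm)]
    rfl
  exact ⟨m, rfl, hm, by omega, by omega⟩

/-- Let `p ≡ 1 (mod 6)` be a prime and `f` the multiplicative order of `5` modulo `p`,
with `3 ∣ f`. If `N` is a friend of 20 and `v₅(N) ≡ −1 (mod f)`, then some odd prime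
`q` dividing `N` has `v_q(N) ≢ −1 (mod f)`. -/
theorem friend20_exponent_not_all_neg_one (p : ℕ) (hp : p.Prime) (hp6 : p % 6 = 1)
    (f : ℕ) (hf : f = orderOf (5 : ZMod p)) (h3f : 3 ∣ f)
    (N : ℕ) (hN : IsFriendOf20 N)
    (hv5 : (N.factorization 5 : ℤ) ≡ -1 [ZMOD (f : ℤ)]) :
    ∃ q : ℕ, q.Prime ∧ Odd q ∧ q ∣ N ∧
      ¬ ((N.factorization q : ℤ) ≡ -1 [ZMOD (f : ℤ)]) := by
  by_contra! hcon
  have h30 := hN.not_thirty_dvd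
  obtain ⟨m, rfl, hodd, h5, hσ⟩ := hN.exists_eq_two_mul
  have hm : m ≠ 0 := by
    rintro rfl
    simp at hodd
  have key : ∀ q : ℕ, q.Prime → Odd q →
      ((2 * m).factorization q : ℤ) ≡ -1 [ZMOD (f : ℤ)] →
      q ^ 2 + q + 1 ∣ ArithmeticFunction.sigma 1 m := by
    intro q hq hqodd hv
    refine sq_add_self_add_one_dvd_sigma_one hq hm ?_
    have hq2 : ¬ q ∣ 2 := fun h => by
      rw [(Nat.prime_dvd_prime_iff_eq hq Nat.prime_two).1 h] at hqodd
      exact absurd hqodd (by decide)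
    have hv3 := hv.of_dvd (Int.natCast_dvd_natCast.2 h3f)
    rw [Nat.factorization_mul two_ne_zero hm, Finsupp.add_apply,
      Nat.factorization_eq_zero_of_not_dvd hq2, zero_add, Int.modEq_iff_dvd] at hv3
    omega
  have h31 : 31 ∣ ArithmeticFunction.sigma 1 m := key 5 Nat.prime_five (by decide) hv5
  have h31m : 31 ∣ m := by omega
  have h993 : 993 ∣ ArithmeticFunction.sigma 1 m :=
    key 31 (by norm_num) (by decide)
      (hcon 31 (by norm_num) (by decide) (h31m.mul_left 2))
  exact h30 (by omega)
end

section
/- If N is a friend of 20, then there exist positive integers a and m, with m odd and coprime to 5, such that N = 2·5^(2a)·m². In particular, N is twice a square times an even power of 5, and every odd prime appears in N with even exponent. -/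
open ArithmeticFunction in
/-- An odd number whose divisor sum is odd is a perfect square. -/
theorem isSquare_of_odd_of_odd_sigma_one {n : ℕ} (hn : Odd n) (hs : Odd (sigma 1 n)) :
    IsSquare n := by
  by_contra hsq
  have hcast : ∀ d : ℕ, d ∣ n → (d : ZMod 2) = 1 := fun d hd =>
    (ZMod.natCast_eq_one_iff_odd).2 (hn.of_dvd_nat hd)
  have hzero : ∑ d ∈ n.divisors, (d : ZMod 2) = 0 := by
    refine Finset.sum_involution (fun d _ => n / d) ?_ ?_ ?_ ?_
    · intro d hd
      have hd := Nat.dvd_of_mem_divisors hd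
      rw [hcast d hd, hcast _ (Nat.div_dvd_of_dvd hd)]
      decide
    · intro d hd _ hfix
      refine hsq ⟨d, ?_⟩
      have hmul := Nat.div_mul_cancel (Nat.dvd_of_mem_divisors hd)
      rw [hfix] at hmul
      exact hmul.symm
    · intro d hd
      exact Nat.mem_divisors.2
        ⟨Nat.div_dvd_of_dvd (Nat.dvd_of_mem_divisors hd), (Nat.mem_divisors.1 hd).2⟩
    · intro d hd
      exact Nat.div_div_self (Nat.dvd_of_mem_divisors hd) (Nat.mem_divisors.1 hd).2
  rw [sigma_one_apply, ← ZMod.natCast_eq_one_iff_odd, Nat.cast_sum, hzero] at hs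
  exact absurd hs (by decide)

open ArithmeticFunction in
/-- The abundancy index strictly increases when passing to a proper multiple. -/
theorem mul_sigma_one_lt_sigma_one_mul {n k : ℕ} (hn : n ≠ 0) (hk : 1 < k) :
    k * sigma 1 n < sigma 1 (n * k) := by
  have hnk : n * k ≠ 0 := mul_ne_zero hn (by omega)
  have hinj : Set.InjOn (fun d => k * d) (n.divisors : Set ℕ) := fun a _ b _ h =>
    Nat.eq_of_mul_eq_mul_left (by omega) h
  rw [sigma_one_apply, sigma_one_apply, Finset.mul_sum,
    ← Finset.sum_image (f := fun d => d) hinj]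
  refine Finset.sum_lt_sum_of_subset (i := 1) ?_ (Nat.one_mem_divisors.2 hnk) ?_ one_pos
    (fun _ _ _ => Nat.zero_le _)
  · intro x hx
    obtain ⟨d, hd, rfl⟩ := Finset.mem_image.1 hx
    rw [Nat.mem_divisors, mul_comm n k]
    exact ⟨mul_dvd_mul_left k (Nat.dvd_of_mem_divisors hd), mul_comm n k ▸ hnk⟩
  · intro hx
    obtain ⟨d, -, hd⟩ := Finset.mem_image.1 hx
    exact hk.ne' (Nat.eq_one_of_mul_eq_one_right hd)

/-- A friend of `20` is twice an odd square divisible by `25`. -/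
theorem IsFriendOf20.exists_eq_two_mul_sq {N : ℕ} (hN : IsFriendOf20 N) :
    ∃ s : ℕ, Odd s ∧ 5 ∣ s ∧ N = 2 * s ^ 2 := by
  obtain ⟨hlt, heq⟩ := hN
  obtain ⟨M, rfl⟩ : 10 ∣ N := by omega
  have hodd : Odd (5 * M) := by
    rw [← Nat.not_even_iff_odd]
    intro heven
    obtain ⟨k, rfl⟩ : 2 ∣ M := by
      obtain ⟨r, hr⟩ := heven
      omega
    have h := mul_sigma_one_lt_sigma_one_mul (n := 20) (k := k) (by norm_num) (by omega)
    have h20 : ArithmeticFunction.sigma 1 20 = 42 := by decide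
    rw [h20, show 20 * k = 10 * (2 * k) by ring] at h
    omega
  have h2 : ArithmeticFunction.sigma 1 2 = 3 := by decide
  rw [show 10 * M = 2 * (5 * M) by ring,
    ArithmeticFunction.isMultiplicative_sigma.map_mul_of_coprime hodd.coprime_two_left, h2] at heq
  have hsigma : Odd (ArithmeticFunction.sigma 1 (5 * M)) := by
    rw [Nat.odd_iff] at hodd ⊢
    omega
  obtain ⟨s, hs⟩ := isSquare_of_odd_of_odd_sigma_one hodd hsigma
  refine ⟨s, ?_, ?_, by rw [sq, ← hs]; ring⟩
  · rw [hs] at hodd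
    exact (Nat.odd_mul.1 hodd).1
  · exact (Nat.prime_five.dvd_mul.1 (hs ▸ Dvd.intro M rfl)).elim id id

/-- A friend of 20 equals `2·5^(2a)·m²` with `m` odd and coprime to 5; in particular
every odd prime divides `N` to an even power. -/
theorem friend20_shape (N : ℕ) (hN : IsFriendOf20 N) :
    (∃ a m : ℕ, 0 < a ∧ 0 < m ∧ Odd m ∧ Nat.Coprime m 5 ∧
        N = 2 * 5 ^ (2 * a) * m ^ 2) ∧
      (∀ p : ℕ, p.Prime → Odd p → Even (N.factorization p)) := by
  obtain ⟨s, hs, h5, rfl⟩ := hN.exists_eq_two_mul_sq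
  have hs0 : s ≠ 0 := hs.pos.ne'
  constructor
  · obtain ⟨a, m, hm, rfl⟩ := Nat.exists_eq_pow_mul_and_not_dvd hs0 5 (by norm_num)
    have hmodd := (Nat.odd_mul.1 hs).2
    refine ⟨a, m, Nat.pos_of_ne_zero ?_, hmodd.pos, hmodd,
      ((Nat.Prime.coprime_iff_not_dvd Nat.prime_five).2 hm).symm, by ring⟩
    rintro rfl
    exact hm (by simpa using h5)
  · intro p hp hpodd
    have hp2 : p ≠ 2 := by
      rintro rfl
      exact absurd hpodd (by decide)
    rw [Nat.factorization_mul two_ne_zero (pow_ne_zero 2 hs0), Nat.factorization_pow]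
    simp [Nat.prime_two.factorization, hp2.symm]
end

section
/- If N is a friend of 20, then N has at least five distinct prime divisors, i.e. ω(N) ≥ 5. -/
/-- The abundancy index is strictly monotone along divisibility. -/
lemma sigma_one_mul_add_le {d e : ℕ} (hd : 0 < d) (he : 1 < e) :
    ArithmeticFunction.sigma 1 d * e + 1 ≤ ArithmeticFunction.sigma 1 (d * e) := by
  rw [ArithmeticFunction.sigma_one_apply, ArithmeticFunction.sigma_one_apply, Finset.sum_mul]
  have hinj : Set.InjOn (fun x : ℕ => x * e) (d.divisors : Set ℕ) :=
    fun a _ b _ h => Nat.eq_of_mul_eq_mul_right (by omega) h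
  have hnot : 1 ∉ d.divisors.image (fun x => x * e) := by
    simp only [Finset.mem_image, not_exists, not_and]
    intro x _ h
    exact absurd (Nat.eq_one_of_mul_eq_one_left h) (by omega)
  have hsub : insert 1 (d.divisors.image (fun x => x * e)) ⊆ (d * e).divisors := by
    intro x hx
    have hde : d * e ≠ 0 := by positivity
    rcases Finset.mem_insert.1 hx with rfl | hx
    · simp [hde]
    · obtain ⟨y, hy, rfl⟩ := Finset.mem_image.1 hx
      exact Nat.mem_divisors.2 ⟨Nat.mul_dvd_mul_right (Nat.dvd_of_mem_divisors hy) e, hde⟩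
  have h := Finset.sum_le_sum_of_subset (f := fun x : ℕ => x) hsub
  rw [Finset.sum_insert hnot, Finset.sum_image hinj] at h
  omega

lemma sigma_one_mul_le {d e : ℕ} (hd : 0 < d) (he : 0 < e) :
    ArithmeticFunction.sigma 1 d * e ≤ ArithmeticFunction.sigma 1 (d * e) := by
  rcases Nat.lt_or_ge 1 e with h | h
  · exact (Nat.le_succ _).trans (sigma_one_mul_add_le hd h)
  · obtain rfl : e = 1 := by omega
    simp

lemma even_of_odd_geom_sum {p k : ℕ} (hp : Odd p)
    (h : Odd (∑ i ∈ Finset.range (k + 1), p ^ i)) : Even k := by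
  rw [Finset.odd_sum_iff_odd_card_odd, Finset.filter_true_of_mem fun i _ => hp.pow,
    Finset.card_range] at h
  rcases Nat.even_or_odd k with hk | hk
  · exact hk
  · exact absurd h (Nat.not_odd_iff_even.2 hk.add_one)

lemma ZMod.eq_one_of_odd_pow_eq_one_five (x : ZMod 5) (j : ℕ) (h : x ^ (2 * j + 1) = 1) :
    x = 1 := by
  have hsq : x ^ (2 * j) = 1 ∨ x ^ (2 * j) = -1 ∨ x = 0 := by
    have hx : x ^ 2 = 1 ∨ x ^ 2 = -1 ∨ x = 0 := by clear h; revert x; decide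
    rw [pow_mul]
    rcases hx with hx | hx | hx
    · simp [hx]
    · rw [hx]
      rcases neg_one_pow_eq_or (ZMod 5) j with h | h <;> simp [h]
    · exact Or.inr (Or.inr hx)
  have hx1 : x = 1 ∨ x = -1 := by
    rw [pow_succ] at h
    rcases hsq with hs | hs | hs
    · left; simpa [hs] using h
    · right; rw [hs] at h; linear_combination -h
    · rw [hs, mul_zero] at h
      exact absurd h (by decide)
  rcases hx1 with hx | hx
  · exact hx
  · rw [hx, pow_succ, pow_mul] at h
    simp at h
    exact absurd h (by decide)

/-- If `5` divides a geometric sum with an odd number of terms, the ratio is `1` modulo `5` and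
the number of terms is divisible by `5`. -/
lemma five_dvd_geom_sum {p k : ℕ} (hk : Even k)
    (h : 5 ∣ ∑ i ∈ Finset.range (k + 1), p ^ i) : p % 5 = 1 ∧ 5 ∣ k + 1 := by
  have h0 : ∑ i ∈ Finset.range (k + 1), (p : ZMod 5) ^ i = 0 := by
    exact_mod_cast (ZMod.natCast_eq_zero_iff _ 5).2 h
  have hp : (p : ZMod 5) = 1 := by
    obtain ⟨j, rfl⟩ := hk
    apply ZMod.eq_one_of_odd_pow_eq_one_five _ j
    have := geom_sum_mul (p : ZMod 5) (j + j + 1)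
    rw [h0, zero_mul] at this
    rw [two_mul]
    exact (sub_eq_zero.1 this.symm)
  refine ⟨?_, ?_⟩
  · exact (ZMod.natCast_eq_natCast_iff' p 1 5).1 (by simpa using hp)
  · rw [hp] at h0
    rw [← ZMod.natCast_eq_zero_iff]
    simpa using h0

lemma geom_sum_dvd_geom_sum (p n t : ℕ) :
    ∑ i ∈ Finset.range n, p ^ i ∣ ∑ i ∈ Finset.range (n * t), p ^ i := by
  induction t with
  | zero => simp
  | succ t ih =>
    rw [Nat.mul_succ, Finset.sum_range_add]
    refine dvd_add ih ?_
    simp_rw [pow_add, ← Finset.mul_sum]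
    exact dvd_mul_left _ _

lemma sigma_one_eq_prod {m : ℕ} (hm : m ≠ 0) : ArithmeticFunction.sigma 1 m =
    ∏ p ∈ m.primeFactors, ∑ i ∈ Finset.range (m.factorization p + 1), p ^ i := by
  rw [ArithmeticFunction.sigma_one_apply, Nat.sum_divisors hm]

lemma sigma_one_mul_prod_le {m : ℕ} (hm : m ≠ 0) :
    ArithmeticFunction.sigma 1 m * ∏ p ∈ m.primeFactors, (p - 1) ≤
      m * ∏ p ∈ m.primeFactors, p := by
  have hfac : m = ∏ p ∈ m.primeFactors, p ^ m.factorization p :=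
    (Nat.prod_factorization_pow_eq_self hm).symm
  conv_rhs => lhs; rw [hfac]
  rw [sigma_one_eq_prod hm, ← Finset.prod_mul_distrib, ← Finset.prod_mul_distrib]
  refine Finset.prod_le_prod' fun p hp => ?_
  obtain ⟨s, rfl⟩ := Nat.exists_eq_succ_of_ne_zero (Nat.prime_of_mem_primeFactors hp).ne_zero
  have h := geom_sum_mul_add s (m.factorization (s + 1) + 1)
  rw [pow_succ] at h
  simp only [Nat.succ_eq_add_one, Nat.add_sub_cancel]
  omega

/-- An odd number with abundancy index `7 / 5` has at least four prime divisors. -/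
lemma four_le_card_primeFactors {m : ℕ} (hodd : Odd m)
    (h : 5 * ArithmeticFunction.sigma 1 m = 7 * m) : 4 ≤ m.primeFactors.card := by
  by_contra! hcard
  have hm : m ≠ 0 := by rintro rfl; simp at hodd
  have hprod := sigma_one_eq_prod hm
  have hsig : Odd (ArithmeticFunction.sigma 1 m) := by
    have : Odd (5 * ArithmeticFunction.sigma 1 m) := h ▸ (by decide : Odd 7).mul hodd
    exact (Nat.odd_mul.1 this).2
  have heven : ∀ p ∈ m.primeFactors, Even (m.factorization p) := fun p hp =>
    even_of_odd_geom_sum (hodd.of_dvd_nat (Nat.dvd_of_mem_primeFactors hp))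
      (hsig.of_dvd_nat (hprod ▸ Finset.dvd_prod_of_mem _ hp))
  have hsq : ∀ p, p.Prime → p ∣ m → p ^ 2 ∣ m := by
    intro p hp hpm
    have he := heven p (Nat.mem_primeFactors.2 ⟨hp, hpm, hm⟩)
    have h1 := hp.factorization_pos_of_dvd hm hpm
    rw [hp.pow_dvd_iff_le_factorization hm]
    obtain ⟨j, hj⟩ := he
    omega
  have h5 : 5 ∣ m := by omega
  have h25 : 5 ^ 2 ∣ m := hsq 5 (by norm_num) h5
  have hsmall : ∀ d, 0 < d → d ∣ m → 5 * ArithmeticFunction.sigma 1 d ≤ 7 * d := by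
    rintro d hd ⟨e, rfl⟩
    have he : 0 < e := Nat.pos_of_ne_zero (by rintro rfl; simp at hm)
    have := sigma_one_mul_le hd he
    refine Nat.le_of_mul_le_mul_right ?_ he
    nlinarith
  have hsmall_prime : ∀ q, q.Prime → q ≠ 5 → q ∣ m → 155 * (1 + q + q ^ 2) ≤ 175 * q ^ 2 := by
    intro q hq hq5 hqm
    have hcop : Nat.Coprime (5 ^ 2) (q ^ 2) :=
      Nat.Coprime.pow 2 2 ((Nat.coprime_primes Nat.prime_five hq).2 hq5.symm)
    have hd := hsmall _ (by have := hq.pos; positivity)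
      (hcop.mul_dvd_of_dvd_of_dvd h25 (hsq q hq hqm))
    rw [ArithmeticFunction.isMultiplicative_sigma.map_mul_of_coprime hcop,
      ArithmeticFunction.sigma_one_apply_prime_pow Nat.prime_five,
      ArithmeticFunction.sigma_one_apply_prime_pow hq] at hd
    simp only [Finset.sum_range_succ, Finset.sum_range_zero, pow_zero, pow_one] at hd
    omega
  have h3 : ¬ 3 ∣ m := fun h3 =>
    absurd (hsmall_prime 3 Nat.prime_three (by norm_num) h3) (by norm_num)
  have h7 : ¬ 7 ∣ m := fun h7 =>
    absurd (hsmall_prime 7 Nat.prime_seven (by norm_num) h7) (by norm_num)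
  have hge : ∀ p ∈ m.primeFactors, p ≠ 5 → 11 ≤ p := by
    intro p hp hp5
    have hpp := Nat.prime_of_mem_primeFactors hp
    have hpm := Nat.dvd_of_mem_primeFactors hp
    by_contra! hlt
    have h2 : ¬ 2 ∣ m := hodd.not_two_dvd_nat
    interval_cases p <;> contradiction
  obtain ⟨p, hp, hp5⟩ : ∃ p ∈ m.primeFactors,
      5 ∣ ∑ i ∈ Finset.range (m.factorization p + 1), p ^ i := by
    have : 5 ∣ ArithmeticFunction.sigma 1 m := by omega
    rw [hprod] at this
    exact (Nat.prime_five.prime.dvd_finsetProd_iff _).1 this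
  obtain ⟨hpmod, t, ht⟩ := five_dvd_geom_sum (heven p hp) hp5
  have hquint : ∑ i ∈ Finset.range 5, p ^ i ∣ 7 * m := by
    refine (geom_sum_dvd_geom_sum p 5 t).trans ?_
    rw [← ht, ← h, hprod]
    exact (Finset.dvd_prod_of_mem _ hp).mul_left 5
  have hpne : p ≠ 5 := by omega
  have hp11 := hge p hp hpne
  have hmem5 : 5 ∈ m.primeFactors := Nat.mem_primeFactors.2 ⟨by norm_num, h5, hm⟩
  have hle := sigma_one_mul_prod_le hm
  have hle' : 7 * ∏ q ∈ m.primeFactors, (q - 1) ≤ 5 * ∏ q ∈ m.primeFactors, q := by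
    refine Nat.le_of_mul_le_mul_left ?_ (Nat.pos_of_ne_zero hm)
    calc m * (7 * ∏ q ∈ m.primeFactors, (q - 1))
        = 5 * (ArithmeticFunction.sigma 1 m * ∏ q ∈ m.primeFactors, (q - 1)) := by
          rw [← mul_assoc 5, h]; ring
      _ ≤ 5 * (m * ∏ q ∈ m.primeFactors, q) := Nat.mul_le_mul_left 5 hle
      _ = m * (5 * ∏ q ∈ m.primeFactors, q) := by ring
  have hpmem : p ∈ m.primeFactors.erase 5 := Finset.mem_erase.2 ⟨hpne, hp⟩
  rw [← Finset.mul_prod_erase _ _ hmem5, ← Finset.mul_prod_erase _ _ hpmem,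
    ← Finset.mul_prod_erase _ _ hmem5, ← Finset.mul_prod_erase _ _ hpmem] at hle'
  have hc : ((m.primeFactors.erase 5).erase p).card ≤ 1 := by
    rw [Finset.card_erase_of_mem hpmem, Finset.card_erase_of_mem hmem5]
    omega
  rcases Finset.card_le_one_iff_subset_singleton.1 hc with ⟨r, hr⟩
  rcases Finset.subset_singleton_iff.1 hr with hr | hr
  · rw [hr] at hle'
    simp only [Finset.prod_empty] at hle'
    omega
  have hrm : r ∈ (m.primeFactors.erase 5).erase p := by simp [hr]
  simp only [Finset.mem_erase] at hrm
  obtain ⟨hrp, hr5, hrm⟩ := hrm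
  have hr11 := hge r hrm hr5
  have hpp := Nat.prime_of_mem_primeFactors hp
  rw [hr, Finset.prod_singleton, Finset.prod_singleton] at hle'
  have hmem : ∀ q, q.Prime → q ∣ 7 * m → q = 7 ∨ q = 5 ∨ q = p ∨ q = r := by
    intro q hq hqm
    rcases (Nat.Prime.dvd_mul hq).1 hqm with h | h
    · left; exact (Nat.prime_dvd_prime_iff_eq hq (by norm_num)).1 h
    · by_contra! hne
      have : q ∈ (m.primeFactors.erase 5).erase p := by
        simp [hne, hq, h, hm]
      rw [hr, Finset.mem_singleton] at this
      exact hne.2.2.2 this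
  obtain ⟨a, rfl⟩ := Nat.exists_eq_add_of_le hp11
  obtain ⟨b, rfl⟩ := Nat.exists_eq_add_of_le hr11
  have hbound : 15 * a + 15 * b + 9 * (a * b) ≤ 675 := by
    have h1 : 11 + a - 1 = 10 + a := by omega
    have h2 : 11 + b - 1 = 10 + b := by omega
    rw [h1, h2] at hle'
    nlinarith
  have hlarge : ∀ q, q.Prime → 75 < q → q ∣ ∑ i ∈ Finset.range 5, (11 + a) ^ i → False := by
    intro q hq hq75 hdvd
    rcases hmem q hq (hdvd.trans hquint) with h | h | h | h <;> omega
  have ha : a = 0 ∨ a = 20 ∨ a = 30 := by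
    have ha45 : a ≤ 45 := by omega
    clear hle' hquint hmem hlarge
    interval_cases a <;> first | omega | (revert hpp; norm_num)
  rcases ha with rfl | rfl | rfl
  · exact hlarge 3221 (by norm_num) (by norm_num) (by decide)
  · exact hlarge 17351 (by norm_num) (by norm_num) (by decide)
  · exact hlarge 579281 (by norm_num) (by norm_num) (by decide)

/-- A friend of 20 has at least five distinct prime divisors. -/
theorem friend20_omega_ge_five (N : ℕ) (hN : IsFriendOf20 N) :
    5 ≤ N.primeFactors.card := by
  obtain ⟨h20, h⟩ := hN
  have hnot : ¬ 20 ∣ N := by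
    rintro ⟨e, rfl⟩
    have := sigma_one_mul_add_le (d := 20) (e := e) (by norm_num) (by omega)
    rw [show ArithmeticFunction.sigma 1 20 = 42 by decide] at this
    omega
  obtain ⟨m, rfl⟩ : 2 ∣ N := by omega
  have hodd : Odd m := by
    rw [Nat.odd_iff]
    omega
  have hcop : Nat.Coprime 2 m := Nat.coprime_two_left.2 hodd
  rw [ArithmeticFunction.isMultiplicative_sigma.map_mul_of_coprime hcop,
    show ArithmeticFunction.sigma 1 2 = 3 by decide] at h
  have := four_le_card_primeFactors hodd (by omega)
  rw [hcop.primeFactors_mul, Finset.card_union_of_disjoint hcop.disjoint_primeFactors,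
    Nat.prime_two.primeFactors, Finset.card_singleton]
  omega
end

section
/- Let N = 2·5^(2a)·m² be a friend of 20, where a and m are positive integers with m odd and coprime to 5. Then Ω(m) ≥ ω(N) + 2a − 3, and consequently Ω(m) ≥ ω(m) + 2a − 1. -/
open ArithmeticFunction

/-- If `5` divides `1 + x + ⋯ + x ^ (2e)` then `x ≡ 1 (mod 5)`: the order of `x` modulo `5` is odd
and divides `4`. -/
theorem mod_five_eq_one_of_dvd_geom_sum {x e : ℕ}
    (h : 5 ∣ ∑ i ∈ Finset.range (2 * e + 1), x ^ i) : x % 5 = 1 := by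
  have hpow : (x : ZMod 5) ^ (2 * e + 1) = 1 := by
    have hgeom := geom_sum_mul (x : ZMod 5) (2 * e + 1)
    have hzero : ∑ i ∈ Finset.range (2 * e + 1), (x : ZMod 5) ^ i = 0 := by
      have := (ZMod.natCast_eq_zero_iff _ 5).2 h
      push_cast at this
      exact this
    rw [hzero, zero_mul] at hgeom
    exact (sub_eq_zero.1 hgeom.symm)
  have hone : (x : ZMod 5) = 1 := by
    generalize (x : ZMod 5) = y at hpow
    rw [pow_succ, pow_mul] at hpow
    have hsq : y ^ 2 = 0 ∨ y ^ 2 = 1 ∨ y ^ 2 = -1 := by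
      clear hpow
      revert y
      decide
    rcases hsq with hsq | hsq | hsq <;> rw [hsq] at hpow
    · rcases Nat.eq_zero_or_pos e with rfl | he
      · simpa using hpow
      · rw [zero_pow he.ne', zero_mul] at hpow
        exact absurd hpow (by decide)
    · simpa using hpow
    · rcases neg_one_pow_eq_or (ZMod 5) e with he | he <;> rw [he] at hpow <;>
        revert y <;> decide
  have := (ZMod.natCast_eq_natCast_iff' x 1 5).1 (by simpa using hone)
  simpa using this

theorem padicValNat_five_two_mul_add_one_lt {e : ℕ} (he : 0 < e) :
    padicValNat 5 (2 * e + 1) < e := by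
  by_contra! hle
  have hdvd : 5 ^ e ∣ 2 * e + 1 := (pow_dvd_pow 5 hle).trans pow_padicValNat_dvd
  have hbound := Nat.le_of_dvd (by omega) hdvd
  have hbern : 1 + e * 4 ≤ 5 ^ e := by
    have := one_add_mul_le_pow_of_sq_nonneg (a := (4 : ℕ)) (by simp) (by simp) (by simp) e
    simpa using this
  omega

theorem padicValNat_five_sigma_prime_pow_lt {p e : ℕ} (hp : p.Prime) (he : 0 < e) :
    padicValNat 5 (sigma 1 (p ^ (2 * e))) < e := by
  have : Fact (Nat.Prime 5) := ⟨by norm_num⟩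
  have hsigma : sigma 1 (p ^ (2 * e)) = ∑ i ∈ Finset.range (2 * e + 1), p ^ i := by
    rw [sigma_one_apply_prime_pow hp]
  by_cases h5 : 5 ∣ sigma 1 (p ^ (2 * e))
  · have hmod : p % 5 = 1 := mod_five_eq_one_of_dvd_geom_sum (hsigma ▸ h5)
    have hp2 := hp.two_le
    have hgeom : sigma 1 (p ^ (2 * e)) * (p - 1) = p ^ (2 * e + 1) - 1 ^ (2 * e + 1) := by
      rw [hsigma, Nat.geomSum_eq hp2, one_pow,
        Nat.div_mul_cancel (by simpa using Nat.sub_dvd_pow_sub_pow p 1 (2 * e + 1))]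
    have hne : sigma 1 (p ^ (2 * e)) ≠ 0 := by
      rw [Ne, sigma_eq_zero]
      exact pow_ne_zero _ hp.ne_zero
    have hlte := padicValNat.pow_sub_pow (p := 5) (x := p) (y := 1) (by decide) (by omega)
      (by omega) (by omega) (n := 2 * e + 1) (by omega)
    rw [← hgeom, padicValNat.mul hne (by omega)] at hlte
    have := padicValNat_five_two_mul_add_one_lt he
    omega
  · rw [padicValNat.eq_zero_of_not_dvd h5]
    exact he

theorem padicValNat_five_sigma_sq_add_cardDistinctFactors_le {n : ℕ} (hn : n ≠ 0) :
    padicValNat 5 (sigma 1 (n ^ 2)) + cardDistinctFactors n ≤ cardFactors n := by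
  have : Fact (Nat.Prime 5) := ⟨by norm_num⟩
  induction n using Nat.recOnPosPrimePosCoprime with
  | zero => exact absurd rfl hn
  | one => simp
  | prime_pow p e hp he =>
    have := padicValNat_five_sigma_prime_pow_lt hp he
    rw [← pow_mul, mul_comm e 2, cardDistinctFactors_apply_prime_pow hp he.ne',
      cardFactors_apply_prime_pow hp]
    omega
  | coprime x y hx hy hxy ihx ihy =>
    have hx0 : x ≠ 0 := by omega
    have hy0 : y ≠ 0 := by omega
    have hsx : sigma 1 (x ^ 2) ≠ 0 := by rw [Ne, sigma_eq_zero]; positivity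
    have hsy : sigma 1 (y ^ 2) ≠ 0 := by rw [Ne, sigma_eq_zero]; positivity
    rw [mul_pow, isMultiplicative_sigma.map_mul_of_coprime (hxy.pow 2 2),
      padicValNat.mul hsx hsy, cardDistinctFactors_mul hxy, cardFactors_mul hx0 hy0]
    have := ihx hx0
    have := ihy hy0
    omega

theorem two_mul_le_padicValNat_five_sigma_sq_add_one {a m : ℕ} (hm : 0 < m)
    (hmodd : Odd m) (hm5 : Nat.Coprime m 5)
    (hN : 10 * sigma 1 (2 * 5 ^ (2 * a) * m ^ 2) = 21 * (2 * 5 ^ (2 * a) * m ^ 2)) :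
    2 * a ≤ padicValNat 5 (sigma 1 (m ^ 2)) + 1 := by
  have : Fact (Nat.Prime 5) := ⟨by norm_num⟩
  have hm2 : Nat.Coprime 2 m := hmodd.coprime_two_left
  have hcop : Nat.Coprime (2 * 5 ^ (2 * a)) (m ^ 2) :=
    (Nat.Coprime.mul_left hm2 (hm5.symm.pow_left _)).pow_right 2
  have hcop' : Nat.Coprime 2 (5 ^ (2 * a)) := Nat.Coprime.pow_right _ (by norm_num)
  have hsigma2 : sigma 1 2 = 3 := by decide
  rw [isMultiplicative_sigma.map_mul_of_coprime hcop,
    isMultiplicative_sigma.map_mul_of_coprime hcop', hsigma2] at hN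
  have hs5 : Nat.Coprime (5 ^ (2 * a)) (sigma 1 (5 ^ (2 * a))) := by
    refine Nat.Coprime.pow_left _ ((Nat.Prime.coprime_iff_not_dvd (by norm_num)).2 fun h => ?_)
    rw [sigma_one_apply_prime_pow (by norm_num)] at h
    exact absurd (mod_five_eq_one_of_dvd_geom_sum h) (by norm_num)
  have hdvd : 5 ^ (2 * a) ∣ sigma 1 (5 ^ (2 * a)) * (sigma 1 (m ^ 2) * 5) :=
    ⟨7 * m ^ 2, by linarith⟩
  have hne : sigma 1 (m ^ 2) ≠ 0 := by rw [Ne, sigma_eq_zero]; positivity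
  have := (padicValNat_dvd_iff_le (by positivity)).1 (hs5.dvd_of_dvd_mul_left hdvd)
  rwa [padicValNat.mul hne (by norm_num), padicValNat_self] at this

theorem card_primeFactors_two_mul_five_pow_mul_sq {a m : ℕ} (ha : 0 < a)
    (hmodd : Odd m) (hm5 : Nat.Coprime m 5) :
    (2 * 5 ^ (2 * a) * m ^ 2).primeFactors.card = m.primeFactors.card + 2 := by
  have hm2 : Nat.Coprime 2 m := hmodd.coprime_two_left
  have hcop : Nat.Coprime (2 * 5 ^ (2 * a)) (m ^ 2) :=
    (Nat.Coprime.mul_left hm2 (hm5.symm.pow_left _)).pow_right 2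
  have hcop' : Nat.Coprime 2 (5 ^ (2 * a)) := Nat.Coprime.pow_right _ (by norm_num)
  rw [hcop.primeFactors_mul, Finset.card_union_of_disjoint hcop.disjoint_primeFactors,
    hcop'.primeFactors_mul, Finset.card_union_of_disjoint hcop'.disjoint_primeFactors,
    Nat.primeFactors_pow _ (by omega), Nat.primeFactors_pow _ (by omega),
    Nat.Prime.primeFactors (by norm_num), Nat.Prime.primeFactors (by norm_num)]
  simp only [Finset.card_singleton]
  omega

/-- If `N = 2·5^(2a)·m²` is a friend of 20, then `Ω(m) ≥ ω(N) + 2a − 3` and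
consequently `Ω(m) ≥ ω(m) + 2a − 1` (stated additively to avoid truncation). -/
theorem friend20_bigOmega_m_lower (N a m : ℕ) (ha : 0 < a) (hm : 0 < m)
    (hmodd : Odd m) (hm5 : Nat.Coprime m 5)
    (hform : N = 2 * 5 ^ (2 * a) * m ^ 2) (hN : IsFriendOf20 N) :
    N.primeFactors.card + 2 * a ≤ m.primeFactorsList.length + 3 ∧
      m.primeFactors.card + 2 * a ≤ m.primeFactorsList.length + 1 := by
  subst hform
  have hval := two_mul_le_padicValNat_five_sigma_sq_add_one hm hmodd hm5 hN.2
  have hle := padicValNat_five_sigma_sq_add_cardDistinctFactors_le hm.ne'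
  have hω : cardDistinctFactors m = m.primeFactors.card := rfl
  rw [hω, cardFactors_apply] at hle
  rw [card_primeFactors_two_mul_five_pow_mul_sq ha hmodd hm5]
  omega
end

section
/- Let N be a friend of 20 and let q be an odd prime divisor of N with q^(2a_q) exactly dividing N (i.e. v_q(N) = 2a_q). Then every prime divisor p of σ(q^(2a_q)) satisfies p = 7 or p divides N/2 (i.e. p is an odd prime dividing N). -/
open ArithmeticFunction in
/-- A proper multiple of `20` has abundancy index greater than that of `20`. -/
theorem lt_sigma_one_twenty_mul (k : ℕ) (hk : 1 < k) : 42 * k < sigma 1 (20 * k) := by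
  have hsub : insert 1 ((Nat.divisors 20).image (· * k)) ⊆ (20 * k).divisors := by
    intro d hd
    rw [Nat.mem_divisors]
    refine ⟨?_, by omega⟩
    rcases Finset.mem_insert.1 hd with rfl | hd
    · exact one_dvd _
    · obtain ⟨e, he, rfl⟩ := Finset.mem_image.1 hd
      exact Nat.mul_dvd_mul_right (Nat.dvd_of_mem_divisors he) k
  have hone : 1 ∉ (Nat.divisors 20).image (· * k) := by
    intro h
    obtain ⟨e, -, he⟩ := Finset.mem_image.1 h
    have := Nat.eq_one_of_mul_eq_one_left he
    omega
  have hinj : Set.InjOn (· * k) (Nat.divisors 20 : Set ℕ) :=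
    fun a _ b _ hab => Nat.eq_of_mul_eq_mul_right (by omega) hab
  have hle := Finset.sum_le_sum_of_subset (f := fun d : ℕ => d) hsub
  rw [Finset.sum_insert hone, Finset.sum_image hinj, ← Finset.sum_mul,
    show ∑ d ∈ Nat.divisors 20, d = 42 by decide +kernel] at hle
  rw [sigma_one_apply]
  omega

theorem IsFriendOf20.exists_odd_half {N : ℕ} (hN : IsFriendOf20 N) :
    ∃ m, Odd m ∧ N = 2 * m := by
  obtain ⟨hlt, heq⟩ := hN
  have hndvd : ¬ 20 ∣ N := by
    rintro ⟨k, rfl⟩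
    have := lt_sigma_one_twenty_mul k (by omega)
    omega
  exact ⟨N / 2, Nat.odd_iff.2 (by omega), by omega⟩

/-- If `N` is a friend of 20 and `q` is an odd prime divisor of `N` with
`v_q(N) = 2·a_q`, then every prime divisor of `σ(q^(2a_q))` is `7` or divides `N/2`. -/
theorem friend20_prime_divisors_of_sigma (N q aq : ℕ) (hN : IsFriendOf20 N)
    (hq : q.Prime) (hqodd : Odd q) (hqN : q ∣ N)
    (hv : N.factorization q = 2 * aq) :
    ∀ p : ℕ, p.Prime → p ∣ ArithmeticFunction.sigma 1 (q ^ (2 * aq)) →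
      p = 7 ∨ p ∣ N / 2 := by
  intro p hp hpdvd
  obtain ⟨m, hm, rfl⟩ := hN.exists_odd_half
  have hm0 : m ≠ 0 := hm.pos.ne'
  obtain ⟨r, hr⟩ : q ^ (2 * aq) ∣ m := by
    refine Nat.Coprime.dvd_of_dvd_mul_left (hqodd.coprime_two_right.pow_left _) ?_
    rw [← hv]
    exact Nat.ordProj_dvd _ _
  have hcop : Nat.Coprime (q ^ (2 * aq)) r := by
    refine Nat.Coprime.pow_left _ ((Nat.Prime.coprime_iff_not_dvd hq).2 fun hqr => ?_)
    refine Nat.pow_succ_factorization_not_dvd (n := 2 * m) (by omega) hq ?_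
    rw [hv, hr, pow_succ]
    exact (Nat.mul_dvd_mul_left _ hqr).mul_left 2
  have heq := hN.2
  rw [ArithmeticFunction.isMultiplicative_sigma.map_mul_of_coprime hm.coprime_two_left,
    show ArithmeticFunction.sigma 1 2 = 3 by decide +kernel] at heq
  have hmul : ArithmeticFunction.sigma 1 m =
      ArithmeticFunction.sigma 1 (q ^ (2 * aq)) * ArithmeticFunction.sigma 1 r := by
    rw [hr, ArithmeticFunction.isMultiplicative_sigma.map_mul_of_coprime hcop]
  have hp7 : p ∣ 7 * m := by
    rw [show 7 * m = 5 * ArithmeticFunction.sigma 1 m by omega, hmul]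
    exact (hpdvd.mul_right _).mul_left 5
  rw [Nat.mul_div_cancel_left m two_pos]
  exact (hp.dvd_mul.1 hp7).imp_left (Nat.prime_dvd_prime_iff_eq hp (by norm_num)).1
end
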